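/- Assume the reference-dependent random choice rule {p_r}_{r∈X} has an RD-RAM representation. Then {p_r}_{r∈X} has an IRA representation if and only if it satisfies IDA and RIDA. -/

import Mathlib

open Finset
open scoped Classical

namespace RDRAM

noncomputable section

variable {α : Type*} [Fintype α] [DecidableEq α]

/-- `x` is the `R`-maximum of `D`. -/
def IsMaxOf (R : α → α → Prop) (x : α) (D : Finset α) : Prop :=
  x ∈ D ∧ ∀ y ∈ D, R x y

/-- `R` is a linear order: complete, antisymmetric, transitive. -/
structure LinOrd (R : α → α → Prop) : Prop where
  total : ∀ x y, R x y ∨ R y x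
  antisymm : ∀ x y, R x y → R y x → x = y
  trans : ∀ x y z, R x y → R y z → R x z

/-- A reference-dependent random choice rule `p r x S`. -/
structure IsRandomChoiceRule (p : α → α → Finset α → ℝ) : Prop where
  nonneg : ∀ r x S, 0 ≤ p r x S
  support : ∀ r x (S : Finset α), S.Nonempty → r ∈ S → 0 < p r x S → x ∈ S
  sum_one : ∀ r (S : Finset α), S.Nonempty → r ∈ S → ∑ x ∈ S, p r x S = 1

/-- A stochastic choice rule `q x S` (no reference). -/
structure IsStochasticChoiceRule (q : α → Finset α → ℝ) : Prop where
  nonneg : ∀ x S, 0 ≤ q x S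
  support : ∀ x (S : Finset α), S.Nonempty → 0 < q x S → x ∈ S
  sum_one : ∀ S : Finset α, S.Nonempty → ∑ x ∈ S, q x S = 1

/-- A random attention rule `μ D S` for reference `r`. -/
structure IsAttentionRule (r : α) (μ : Finset α → Finset α → ℝ) : Prop where
  nonneg : ∀ D S, 0 ≤ μ D S
  support : ∀ (S D : Finset α), S.Nonempty → r ∈ S → 0 < μ D S → r ∈ D ∧ D ⊆ S
  sum_one : ∀ (S : Finset α), S.Nonempty → r ∈ S → ∑ D ∈ S.powerset, μ D S = 1

/-- Full support: every admissible consideration set has positive probability. -/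
def FullSupport (r : α) (μ : Finset α → Finset α → ℝ) : Prop :=
  ∀ (S D : Finset α), S.Nonempty → r ∈ S → r ∈ D → D ⊆ S → 0 < μ D S

/-- `(R, μ)` is an RD-RAM representation of `p`. -/
def IsRDRAMRep (p : α → α → Finset α → ℝ) (R : α → α → Prop)
    (μ : α → Finset α → Finset α → ℝ) : Prop :=
  LinOrd R ∧ (∀ r, IsAttentionRule r (μ r) ∧ FullSupport r (μ r)) ∧
    ∀ r (S : Finset α), S.Nonempty → r ∈ S → ∀ x ∈ S,
      p r x S = ∑ D ∈ S.powerset.filter (fun D => r ∈ D ∧ IsMaxOf R x D), μ r D S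

/-- Independent Random Attention representation of an attention rule. -/
def HasIRA (r : α) (μ : Finset α → Finset α → ℝ) : Prop :=
  ∃ γ : α → ℝ, γ r = 1 ∧ (∀ x, x ≠ r → 0 < γ x ∧ γ x < 1) ∧
    ∀ (S : Finset α), S.Nonempty → r ∈ S → ∀ D : Finset α, r ∈ D → D ⊆ S →
      μ D S = (∏ x ∈ D, γ x) * ∏ y ∈ S \ D, (1 - γ y)

/-- Luce Random Attention representation of an attention rule. -/
def HasLRA (r : α) (μ : Finset α → Finset α → ℝ) : Prop :=
  ∃ π : Finset α → ℝ, (∀ D : Finset α, r ∈ D → 0 < π D) ∧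
    (∑ D ∈ (univ : Finset α).powerset.filter (fun D => r ∈ D), π D = 1) ∧
    ∀ (S : Finset α), S.Nonempty → r ∈ S → ∀ D : Finset α, r ∈ D → D ⊆ S →
      μ D S = π D / ∑ D' ∈ S.powerset.filter (fun D' => r ∈ D'), π D'

/-- Constant Random Attention representation of an attention rule. -/
def HasCRA (r : α) (μ : Finset α → Finset α → ℝ) : Prop :=
  ∃ π : Finset α → ℝ, (∀ D : Finset α, r ∈ D → 0 < π D) ∧
    (∑ D ∈ (univ : Finset α).powerset.filter (fun D => r ∈ D), π D = 1) ∧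
    ∀ (S : Finset α), S.Nonempty → r ∈ S → ∀ D : Finset α, r ∈ D → D ⊆ S →
      μ D S = ∑ D' ∈ (univ : Finset α).powerset.filter (fun D' => D' ∩ S = D), π D'

/-- `p` has an IRA representation. -/
def HasIRARep (p : α → α → Finset α → ℝ) : Prop :=
  ∃ (R : α → α → Prop) (μ : α → Finset α → Finset α → ℝ),
    IsRDRAMRep p R μ ∧ ∀ r, HasIRA r (μ r)

/-- `p` has an LRA representation. -/
def HasLRARep (p : α → α → Finset α → ℝ) : Prop :=
  ∃ (R : α → α → Prop) (μ : α → Finset α → Finset α → ℝ),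
    IsRDRAMRep p R μ ∧ ∀ r, HasLRA r (μ r)

/-- `p` has a CRA representation. -/
def HasCRARep (p : α → α → Finset α → ℝ) : Prop :=
  ∃ (R : α → α → Prop) (μ : α → Finset α → Finset α → ℝ),
    IsRDRAMRep p R μ ∧ ∀ r, HasCRA r (μ r)

/-- No-Cycle Condition. -/
def NCC (p : α → α → Finset α → ℝ) : Prop :=
  ∀ (n : ℕ) (x : Fin (n + 1) → α) (Sq : Fin (n + 1) → Finset α),
    (∀ i, (Sq i).Nonempty ∧ x i ∈ Sq i) →
    (∀ i : Fin n, x i.succ ∈ Sq i.castSucc ∧ x i.succ ≠ x i.castSucc ∧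
      0 < p (x i.castSucc) (x i.succ) (Sq i.castSucc)) →
    x 0 ∈ Sq (Fin.last n) → x 0 ≠ x (Fin.last n) →
    p (x (Fin.last n)) (x 0) (Sq (Fin.last n)) = 0

/-- Status Quo Asymmetry. -/
def SQA (p : α → α → Finset α → ℝ) : Prop :=
  ∀ x y : α, x ≠ y → ∀ S T : Finset α, x ∈ S → y ∈ S → x ∈ T → y ∈ T →
    p y x S = 0 → 0 < p x y T

/-- Nontrivial Reference Effect. -/
def NRE (p : α → α → Finset α → ℝ) : Prop :=
  ∀ x (S : Finset α), x ∈ S → 0 < p x x S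

/-- Irrelevance of Dominated Alternatives. -/
def IDA (p : α → α → Finset α → ℝ) : Prop :=
  ∀ r (S : Finset α), S.Nonempty → r ∈ S → ∀ x ∈ S, ∀ y ∈ S, y ≠ r → y ≠ x →
    (∃ T : Finset α, x ∈ T ∧ y ∈ T ∧ 0 < p y x T) →
    p r x S = p r x (S.erase y)

/-- Ratio Independence of Dominant Alternatives. -/
def RIDA (p : α → α → Finset α → ℝ) : Prop :=
  ∀ r (S : Finset α), S.Nonempty → r ∈ S → ∀ x ∈ S, x ≠ r →
    ∀ y ∈ S, y ≠ x → ∀ z ∈ S, z ≠ x →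
      p x x S = 1 → 0 < p r y S * p r z S →
      p r y S / p r z S = p r y (S.erase x) / p r z (S.erase x)

/-- `Pset p r`: the set of alternatives that dominate `r`. -/
def Pset (p : α → α → Finset α → ℝ) (r : α) : Finset α :=
  univ.filter (fun s => s ≠ r ∧ ∃ T : Finset α, r ∈ T ∧ s ∈ T ∧ 0 < p r s T)

/-- Odds against the reference alternative. -/
def odds (p : α → α → Finset α → ℝ) (r : α) (S : Finset α) : ℝ :=
  (1 - p r r S) / p r r S

/-- Decreasing Odds for the Reference Alternative. -/
def DORA (p : α → α → Finset α → ℝ) : Prop :=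
  ∀ r (S : Finset α), S.Nonempty → r ∈ S → ∀ (n : ℕ) (U : Fin n → Finset α),
    (∀ i, U i ⊆ Pset p r ∧ (S ∩ U i).Nonempty) →
    0 < ∑ I ∈ (univ : Finset (Fin n)).powerset,
      (-1 : ℝ) ^ I.card * odds p r (S \ I.biUnion U)

/-- Decreasing Propensity of Choice for the Reference Alternative. -/
def DPCRA (p : α → α → Finset α → ℝ) : Prop :=
  ∀ r (S : Finset α), S.Nonempty → r ∈ S → ∀ (n : ℕ) (U : Fin n → Finset α),
    (∀ i, U i ⊆ Pset p r ∧ (S ∩ U i).Nonempty) →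
    0 < ∑ I ∈ (univ : Finset (Fin n)).powerset,
      (-1 : ℝ) ^ (n - I.card) * p r r (S \ I.biUnion U)

/-- Reference-independent CRA representation of a family of attention rules. -/
def RefIndepCRA (μ : α → Finset α → Finset α → ℝ) : Prop :=
  ∃ π : Finset α → ℝ, π ∅ = 0 ∧ (∀ D : Finset α, D.Nonempty → 0 < π D) ∧
    (∑ D ∈ (univ : Finset α).powerset, π D = 1) ∧
    ∀ r (S : Finset α), S.Nonempty → r ∈ S → ∀ D : Finset α, r ∈ D → D ⊆ S →
      μ r D S = ∑ D' ∈ (univ : Finset α).powerset.filter (fun D' => D' ∩ S = D),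
        (π D' + π (D'.erase r))

/-- The monotonicity property of Cattaneo et al. (2020). -/
def MonotonicAttention (r : α) (μ : Finset α → Finset α → ℝ) : Prop :=
  ∀ D S T : Finset α, r ∈ D → D ⊆ S → S ⊆ T → μ D T ≤ μ D S

/-- `(R, γ)` is an IRA representation of `p` (directly, in terms of attention maps). -/
def IsIRAPair (p : α → α → Finset α → ℝ) (R : α → α → Prop) (γ : α → α → ℝ) : Prop :=
  LinOrd R ∧ (∀ r, γ r r = 1 ∧ ∀ x, x ≠ r → 0 < γ r x ∧ γ r x < 1) ∧
    ∀ r (S : Finset α), S.Nonempty → r ∈ S → ∀ x ∈ S,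
      p r x S = ∑ D ∈ S.powerset.filter (fun D => r ∈ D ∧ IsMaxOf R x D),
        ((∏ a ∈ D, γ r a) * ∏ b ∈ S \ D, (1 - γ r b))

set_option linter.unusedSectionVars false

lemma LinOrd.refl {R : α → α → Prop} (h : LinOrd R) (x : α) : R x x :=
  (h.total x x).elim id id

lemma LinOrd.exists_isMaxOf {R : α → α → Prop} (h : LinOrd R) {S : Finset α}
    (hS : S.Nonempty) : ∃ m, IsMaxOf R m S := by
  induction hS using Finset.Nonempty.cons_induction with
  | singleton a => exact ⟨a, by simp [IsMaxOf, h.refl]⟩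
  | cons a s ha hs ih =>
    obtain ⟨m, hm, hmax⟩ := ih
    rcases h.total a m with ham | hma
    · refine ⟨a, by simp, fun y hy => ?_⟩
      rcases Finset.mem_cons.1 hy with rfl | hy
      · exact h.refl _
      · exact h.trans _ _ _ ham (hmax y hy)
    · refine ⟨m, by simp [hm], fun y hy => ?_⟩
      rcases Finset.mem_cons.1 hy with rfl | hy
      · exact hma
      · exact hmax y hy

/-- The probability that `D` is considered in `S` when each alternative `x` is considered
independently with probability `γ x`. -/
def iraWeight (γ : α → ℝ) (D S : Finset α) : ℝ :=
  (∏ x ∈ D, γ x) * ∏ y ∈ S \ D, (1 - γ y)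

/-- The probability that `x` is the best alternative considered in `S`, when attention is
independent with parameters `γ` and the reference is `r`. -/
def iraChoice (R : α → α → Prop) (r : α) (γ : α → ℝ) (x : α) (S : Finset α) : ℝ :=
  ∑ D ∈ S.powerset.filter (fun D => r ∈ D ∧ IsMaxOf R x D), iraWeight γ D S

lemma sum_iraWeight (γ : α → ℝ) (S : Finset α) :
    ∑ D ∈ S.powerset, iraWeight γ D S = 1 := by
  unfold iraWeight
  rw [← Finset.prod_add]
  simp

lemma iraWeight_eq_zero {γ : α → ℝ} {r : α} (hr : γ r = 1) {D S : Finset α} (hS : r ∈ S)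
    (hD : r ∉ D) : iraWeight γ D S = 0 := by
  unfold iraWeight
  rw [Finset.prod_eq_zero (i := r) (s := S \ D) (by simp [hS, hD]) (by simp [hr]), mul_zero]

lemma sum_iraWeight_mem {γ : α → ℝ} {r : α} (hr : γ r = 1) {S : Finset α} (hS : r ∈ S) :
    ∑ D ∈ S.powerset, (if r ∈ D then iraWeight γ D S else 0) = 1 := by
  rw [← sum_iraWeight γ S]
  refine Finset.sum_congr rfl fun D _ => ?_
  split_ifs with h
  · rfl
  · exact (iraWeight_eq_zero hr hS h).symm

lemma iraWeight_insert_insert {γ : α → ℝ} {m : α} {D S : Finset α} (hD : m ∉ D) :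
    iraWeight γ (insert m D) (insert m S) = γ m * iraWeight γ D (S.erase m) := by
  unfold iraWeight
  rw [Finset.prod_insert hD, mul_assoc]
  congr 3
  ext a
  simp only [Finset.mem_sdiff, Finset.mem_insert, Finset.mem_erase]
  tauto

lemma iraWeight_insert {γ : α → ℝ} {m : α} {D S : Finset α} (hD : m ∉ D) (hS : m ∉ S) :
    iraWeight γ D (insert m S) = (1 - γ m) * iraWeight γ D S := by
  unfold iraWeight
  rw [Finset.insert_sdiff_of_notMem _ hD, Finset.prod_insert (by simp [hS])]
  ring

/-- The recursion, on removing the best alternative of the menu, that characterizes choice under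
independent attention with parameters `γ` and reference `r`. -/
structure IRARec (R : α → α → Prop) (r : α) (γ : α → ℝ) (q : α → Finset α → ℝ) : Prop where
  ref : ∀ S, IsMaxOf R r S → ∀ x ∈ S, q x S = if x = r then 1 else 0
  max : ∀ S, r ∈ S → ∀ m, IsMaxOf R m S → m ≠ r → q m S = γ m
  erase : ∀ S, r ∈ S → ∀ m, IsMaxOf R m S → m ≠ r → ∀ x ∈ S, x ≠ m →
    q x S = (1 - γ m) * q x (S.erase m)

lemma IsMaxOf.erase {R : α → α → Prop} {m y : α} {S : Finset α} (h : IsMaxOf R m S)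
    (hy : m ≠ y) : IsMaxOf R m (S.erase y) :=
  ⟨Finset.mem_erase.2 ⟨hy, h.1⟩, fun z hz => h.2 z (Finset.mem_of_mem_erase hz)⟩

lemma iraRec_iraChoice {R : α → α → Prop} (hR : LinOrd R) {r : α} {γ : α → ℝ}
    (hr : γ r = 1) : IRARec R r γ (iraChoice R r γ) where
  ref S hS x hx := by
    unfold iraChoice
    rw [Finset.sum_filter]
    split_ifs with h
    · subst h
      rw [← sum_iraWeight_mem hr hS.1]
      refine Finset.sum_congr rfl fun D hD => if_congr ?_ rfl rfl
      exact ⟨fun h => h.1, fun h => ⟨h, h, fun y hy => hS.2 y (Finset.mem_powerset.1 hD hy)⟩⟩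
    · refine Finset.sum_eq_zero fun D _ => if_neg ?_
      rintro ⟨h1, _, h3⟩
      exact h (hR.antisymm _ _ (h3 r h1) (hS.2 x hx))
  max S hS m hm hmr := by
    unfold iraChoice
    obtain ⟨S, hmS, rfl⟩ : ∃ S', m ∉ S' ∧ S = insert m S' :=
      ⟨S.erase m, by simp, (Finset.insert_erase hm.1).symm⟩
    have hrS : r ∈ S := (Finset.mem_insert.1 hS).resolve_left hmr.symm
    rw [Finset.sum_filter, Finset.sum_powerset_insert hmS, Finset.sum_eq_zero, zero_add,
      ← mul_one (γ m), ← sum_iraWeight_mem hr hrS, Finset.mul_sum]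
    · refine Finset.sum_congr rfl fun D hD => ?_
      have hDS := Finset.mem_powerset.1 hD
      have hmD : m ∉ D := fun h => hmS (hDS h)
      rw [iraWeight_insert_insert hmD, Finset.erase_eq_of_notMem hmS, mul_ite, mul_zero]
      refine if_congr ?_ rfl rfl
      refine ⟨fun h => (Finset.mem_insert.1 h.1).resolve_left hmr.symm, fun h =>
        ⟨Finset.mem_insert_of_mem h, Finset.mem_insert_self _ _, fun y hy =>
          hm.2 y (Finset.insert_subset_insert m hDS hy)⟩⟩
    · exact fun D hD => if_neg fun h => hmS (Finset.mem_powerset.1 hD h.2.1)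
  erase S hS m hm hmr x hx hxm := by
    unfold iraChoice
    obtain ⟨S, hmS, rfl⟩ : ∃ S', m ∉ S' ∧ S = insert m S' :=
      ⟨S.erase m, by simp, (Finset.insert_erase hm.1).symm⟩
    rw [Finset.erase_insert hmS, Finset.sum_filter, Finset.sum_powerset_insert hmS,
      Finset.sum_filter, Finset.mul_sum, add_eq_left.2]
    · refine Finset.sum_congr rfl fun D hD => ?_
      rw [iraWeight_insert (fun h => hmS (Finset.mem_powerset.1 hD h)) hmS, mul_ite, mul_zero]
    · refine Finset.sum_eq_zero fun D _ => if_neg ?_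
      rintro ⟨_, _, h3⟩
      exact hxm (hR.antisymm _ _ (h3 m (Finset.mem_insert_self _ _)) (hm.2 x hx))

lemma IRARec.unique {R : α → α → Prop} (hR : LinOrd R) {r : α} {γ : α → ℝ}
    {q q' : α → Finset α → ℝ} (hq : IRARec R r γ q) (hq' : IRARec R r γ q') {S : Finset α}
    (hS : r ∈ S) {x : α} (hx : x ∈ S) : q x S = q' x S := by
  induction S using Finset.strongInduction with
  | H S ih =>
    obtain ⟨m, hm⟩ := hR.exists_isMaxOf ⟨r, hS⟩
    by_cases hmr : m = r
    · subst hmr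
      rw [hq.ref S hm x hx, hq'.ref S hm x hx]
    by_cases hxm : x = m
    · subst hxm
      rw [hq.max S hS x hm hmr, hq'.max S hS x hm hmr]
    · rw [hq.erase S hS m hm hmr x hx hxm, hq'.erase S hS m hm hmr x hx hxm,
        ih _ (Finset.erase_ssubset hm.1) (Finset.mem_erase.2 ⟨Ne.symm hmr, hS⟩)
          (Finset.mem_erase.2 ⟨hxm, hx⟩)]

lemma IRARec.erase_dominated {R : α → α → Prop} (hR : LinOrd R) {r : α} {γ : α → ℝ}
    {q : α → Finset α → ℝ} (hq : IRARec R r γ q) {S : Finset α} (hS : r ∈ S) {x y : α}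
    (hx : x ∈ S) (hyr : y ≠ r) (hyx : y ≠ x) (hxy : R x y) :
    q x S = q x (S.erase y) := by
  induction S using Finset.strongInduction with
  | H S ih =>
    have hrS : r ∈ S.erase y := Finset.mem_erase.2 ⟨hyr.symm, hS⟩
    have hxS : x ∈ S.erase y := Finset.mem_erase.2 ⟨hyx.symm, hx⟩
    obtain ⟨m, hm⟩ := hR.exists_isMaxOf ⟨r, hS⟩
    have hmy : m ≠ y := by
      rintro rfl
      exact hyx (hR.antisymm _ _ (hm.2 x hx) hxy)
    have hm' := hm.erase hmy
    by_cases hmr : m = r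
    · subst hmr
      rw [hq.ref S hm x hx, hq.ref _ hm' x hxS]
    by_cases hxm : x = m
    · subst hxm
      rw [hq.max S hS x hm hmr, hq.max _ hrS x hm' hmr]
    · rw [hq.erase S hS m hm hmr x hx hxm, hq.erase _ hrS m hm' hmr x hxS hxm,
        ih _ (Finset.erase_ssubset hm.1) (Finset.mem_erase.2 ⟨Ne.symm hmr, hS⟩)
          (Finset.mem_erase.2 ⟨hxm, hx⟩), Finset.erase_right_comm]

section Representation

variable {p : α → α → Finset α → ℝ} {R : α → α → Prop} {μ : α → Finset α → Finset α → ℝ}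

lemma IsRDRAMRep.pos_iff (h : IsRDRAMRep p R μ) {r x : α} {S : Finset α} (hr : r ∈ S)
    (hx : x ∈ S) : 0 < p r x S ↔ R x r := by
  rw [h.2.2 r S ⟨r, hr⟩ hr x hx]
  constructor
  · intro hpos
    obtain ⟨D, hD, -⟩ := Finset.exists_ne_zero_of_sum_ne_zero hpos.ne'
    obtain ⟨-, hrD, hmax⟩ := Finset.mem_filter.1 hD
    exact hmax.2 r hrD
  · intro hxr
    refine Finset.sum_pos' (fun D _ => (h.2.1 r).1.nonneg D S) ⟨{r, x}, ?_, ?_⟩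
    · exact Finset.mem_filter.2 ⟨by simp [Finset.insert_subset_iff, hr, hx], by simp,
        by simp, by simp [hxr, h.1.refl]⟩
    · exact (h.2.1 r).2 S _ ⟨r, hr⟩ hr (by simp) (by simp [Finset.insert_subset_iff, hr, hx])

lemma IsRDRAMRep.eq_zero (h : IsRDRAMRep p R μ) (hp : IsRandomChoiceRule p) {r x : α}
    {S : Finset α} (hr : r ∈ S) (hx : x ∈ S) (hxr : ¬ R x r) : p r x S = 0 :=
  ((hp.nonneg r x S).eq_or_lt.resolve_right fun hpos => hxr ((h.pos_iff hr hx).1 hpos)).symm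

lemma IsRDRAMRep.self_eq_one_iff (h : IsRDRAMRep p R μ) (hp : IsRandomChoiceRule p) {x : α}
    {S : Finset α} (hx : x ∈ S) : p x x S = 1 ↔ IsMaxOf R x S := by
  have hsum := hp.sum_one x S ⟨x, hx⟩ hx
  rw [← Finset.add_sum_erase S _ hx] at hsum
  constructor
  · refine fun h1 => ⟨hx, fun y hy => ?_⟩
    by_contra hxy
    have hyx : y ≠ x := by
      rintro rfl
      exact hxy (h.1.refl _)
    have hpos := (h.pos_iff hx hy).2 ((h.1.total x y).resolve_left hxy)
    have hle := Finset.single_le_sum (f := fun z => p x z S)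
      (fun z _ => hp.nonneg x z S) (Finset.mem_erase.2 ⟨hyx, hy⟩)
    linarith
  · intro hmax
    rw [Finset.sum_eq_zero, add_zero] at hsum
    · exact hsum
    · intro y hy
      obtain ⟨hyx, hy⟩ := Finset.mem_erase.1 hy
      exact h.eq_zero hp hx hy fun hR => hyx (h.1.antisymm _ _ hR (hmax.2 y hy))

lemma IsRDRAMRep.ida_of_iraRec (h : IsRDRAMRep p R μ) {γ : α → α → ℝ}
    (hq : ∀ r, IRARec R r (γ r) (p r)) : IDA p := by
  rintro r S - hr x hx y - hyr hyx ⟨T, hxT, hyT, hpos⟩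
  exact (hq r).erase_dominated h.1 hr hx hyr hyx ((h.pos_iff hyT hxT).1 hpos)

lemma IsRDRAMRep.rida_of_iraRec (h : IsRDRAMRep p R μ) (hp : IsRandomChoiceRule p)
    {γ : α → α → ℝ} (hγ : ∀ r x, x ≠ r → γ r x < 1)
    (hq : ∀ r, IRARec R r (γ r) (p r)) : RIDA p := by
  intro r S _ hr x hx hxr y hy hyx z hz hzx h1 _
  have hm := (h.self_eq_one_iff hp hx).1 h1
  rw [(hq r).erase S hr x hm hxr y hy hyx, (hq r).erase S hr x hm hxr z hz hzx]
  exact mul_div_mul_left _ _ (sub_pos.2 (hγ r x hxr)).ne'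

lemma IsRDRAMRep.eq_pair (h : IsRDRAMRep p R μ) (hida : IDA p) {r m : α} {S : Finset α}
    (hr : r ∈ S) (hm : IsMaxOf R m S) : p r m S = p r m {r, m} := by
  induction S using Finset.strongInduction with
  | H S ih =>
    by_cases hy : ∃ y ∈ S, y ≠ r ∧ y ≠ m
    · obtain ⟨y, hy, hyr, hym⟩ := hy
      rw [hida r S ⟨r, hr⟩ hr m hm.1 y hy hyr hym ⟨{m, y}, by simp, by simp,
        (h.pos_iff (by simp) (by simp)).2 (hm.2 y hy)⟩]
      exact ih _ (Finset.erase_ssubset hy) (Finset.mem_erase.2 ⟨hyr.symm, hr⟩)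
        (hm.erase hym.symm)
    · congr 1
      refine Finset.Subset.antisymm (fun y hyS => ?_)
        (by simp [Finset.insert_subset_iff, hr, hm.1])
      by_contra hne
      simp only [Finset.mem_insert, Finset.mem_singleton, not_or] at hne
      exact hy ⟨y, hyS, hne⟩

lemma IsRDRAMRep.eq_mul_erase (h : IsRDRAMRep p R μ) (hp : IsRandomChoiceRule p)
    (hrida : RIDA p) {r m x : α} {S : Finset α} (hr : r ∈ S) (hm : IsMaxOf R m S)
    (hmr : m ≠ r) (hx : x ∈ S) (hxm : x ≠ m) :
    p r x S = (1 - p r m S) * p r x (S.erase m) := by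
  have hr' : r ∈ S.erase m := Finset.mem_erase.2 ⟨hmr.symm, hr⟩
  have hrr := (h.pos_iff hr hr).2 (h.1.refl r)
  have hrr' := (h.pos_iff hr' hr').2 (h.1.refl r)
  have key : ∀ y ∈ S.erase m, p r y S = p r r S / p r r (S.erase m) * p r y (S.erase m) := by
    intro y hy'
    obtain ⟨hym, hy⟩ := Finset.mem_erase.1 hy'
    by_cases hyr : R y r
    · have := hrida r S ⟨r, hr⟩ hr m hm.1 hmr y hy hym r hr hmr.symm
        ((h.self_eq_one_iff hp hm.1).2 hm) (mul_pos ((h.pos_iff hr hy).2 hyr) hrr)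
      rw [div_eq_div_iff hrr.ne' hrr'.ne'] at this
      field_simp
      linarith
    · rw [h.eq_zero hp hr hy hyr, h.eq_zero hp hr' hy' hyr, mul_zero]
  have hsum := hp.sum_one r S ⟨r, hr⟩ hr
  rw [← Finset.add_sum_erase S _ hm.1, Finset.sum_congr rfl key, ← Finset.mul_sum,
    hp.sum_one r _ ⟨r, hr'⟩ hr', mul_one] at hsum
  rw [key x (Finset.mem_erase.2 ⟨hxm, hx⟩), ← hsum]
  ring

/-- The attention parameters revealed by binary menus; alternatives dominated by the reference
are never chosen, so their parameter is arbitrary. -/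
def revealedAttention (p : α → α → Finset α → ℝ) (R : α → α → Prop) (r x : α) : ℝ :=
  if x = r then 1 else if R x r then p r x {r, x} else 1 / 2

lemma IsRDRAMRep.revealedAttention_mem (h : IsRDRAMRep p R μ) (hp : IsRandomChoiceRule p)
    {r x : α} (hxr : x ≠ r) : 0 < revealedAttention p R r x ∧ revealedAttention p R r x < 1 := by
  unfold revealedAttention
  rw [if_neg hxr]
  split_ifs with hR
  · have hsum := hp.sum_one r {r, x} (by simp) (by simp)
    rw [Finset.sum_pair hxr.symm] at hsum
    have h1 : 0 < p r r {r, x} := (h.pos_iff (by simp) (by simp)).2 (h.1.refl r)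
    exact ⟨(h.pos_iff (by simp) (by simp)).2 hR, by linarith⟩
  · norm_num

lemma IsRDRAMRep.iraRec (h : IsRDRAMRep p R μ) (hp : IsRandomChoiceRule p) (hida : IDA p)
    (hrida : RIDA p) (r : α) : IRARec R r (revealedAttention p R r) (p r) := by
  have hmax : ∀ S, r ∈ S → ∀ m, IsMaxOf R m S → m ≠ r →
      p r m S = revealedAttention p R r m := by
    intro S hr m hm hmr
    rw [revealedAttention, if_neg hmr, if_pos (hm.2 r hr), h.eq_pair hida hr hm]
  refine ⟨fun S hS x hx => ?_, hmax, fun S hr m hm hmr x hx hxm => ?_⟩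
  · split_ifs with hxr
    · subst hxr
      exact (h.self_eq_one_iff hp hx).2 hS
    · exact h.eq_zero hp hS.1 hx fun hR => hxr (h.1.antisymm _ _ hR (hS.2 x hx))
  · rw [← hmax S hr m hm hmr]
    exact h.eq_mul_erase hp hrida hr hm hmr hx hxm

end Representation

/-- The random attention rule with independent attention parameters `γ`. -/
def iraRule (γ : α → ℝ) (D S : Finset α) : ℝ :=
  if D ⊆ S then iraWeight γ D S else 0

lemma isAttentionRule_iraRule {r : α} {γ : α → ℝ} (hr : γ r = 1)
    (hγ : ∀ x, x ≠ r → 0 < γ x ∧ γ x < 1) : IsAttentionRule r (iraRule γ) where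
  nonneg D S := by
    have h01 : ∀ x, 0 ≤ γ x ∧ γ x ≤ 1 := fun x => by
      by_cases hx : x = r
      · simp [hx, hr]
      · exact ⟨(hγ x hx).1.le, (hγ x hx).2.le⟩
    unfold iraRule iraWeight
    split_ifs
    · exact mul_nonneg (Finset.prod_nonneg fun x _ => (h01 x).1)
        (Finset.prod_nonneg fun x _ => sub_nonneg.2 (h01 x).2)
    · exact le_rfl
  support S D _ hrS hpos := by
    unfold iraRule at hpos
    split_ifs at hpos with hDS
    · exact ⟨by_contra fun hD => hpos.ne' (iraWeight_eq_zero hr hrS hD), hDS⟩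
    · exact absurd hpos (lt_irrefl 0)
  sum_one S _ _ := by
    rw [← sum_iraWeight γ S]
    exact Finset.sum_congr rfl fun D hD => if_pos (Finset.mem_powerset.1 hD)

lemma fullSupport_iraRule {r : α} {γ : α → ℝ} (hr : γ r = 1)
    (hγ : ∀ x, x ≠ r → 0 < γ x ∧ γ x < 1) : FullSupport r (iraRule γ) := by
  intro S D _ _ hrD hDS
  rw [iraRule, if_pos hDS]
  refine mul_pos (Finset.prod_pos fun x _ => ?_) (Finset.prod_pos fun x hx => sub_pos.2 ?_)
  · by_cases hx : x = r
    · simp [hx, hr]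
    · exact (hγ x hx).1
  · refine (hγ x ?_).2
    rintro rfl
    exact (Finset.mem_sdiff.1 hx).2 hrD

/-- an RD-RAM has an IRA representation iff it satisfies IDA and RIDA. -/
theorem ira_characterization (h2 : 2 ≤ Fintype.card α)
    (p : α → α → Finset α → ℝ) (hp : IsRandomChoiceRule p)
    (hrd : ∃ (R : α → α → Prop) (μ : α → Finset α → Finset α → ℝ), IsRDRAMRep p R μ) :
    HasIRARep p ↔ IDA p ∧ RIDA p := by
  constructor
  · rintro ⟨R, μ, h, hira⟩
    choose γ hγr hγ hμ using hira
    have hrec : ∀ r, IRARec R r (γ r) (p r) := by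
      intro r
      have hq := iraRec_iraChoice h.1 (hγr r)
      have heq : ∀ S, r ∈ S → ∀ x ∈ S, p r x S = iraChoice R r (γ r) x S := by
        intro S hr x hx
        rw [h.2.2 r S ⟨r, hr⟩ hr x hx]
        refine Finset.sum_congr rfl fun D hD => ?_
        obtain ⟨hDS, hrD, -⟩ := Finset.mem_filter.1 hD
        exact hμ r S ⟨r, hr⟩ hr D hrD (Finset.mem_powerset.1 hDS)
      refine ⟨fun S hS x hx => ?_, fun S hr m hm hmr => ?_, fun S hr m hm hmr x hx hxm => ?_⟩
      · rw [heq S hS.1 x hx, hq.ref S hS x hx]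
      · rw [heq S hr m hm.1, hq.max S hr m hm hmr]
      · rw [heq S hr x hx, heq _ (Finset.mem_erase.2 ⟨hmr.symm, hr⟩) x
          (Finset.mem_erase.2 ⟨hxm, hx⟩), hq.erase S hr m hm hmr x hx hxm]
    exact ⟨h.ida_of_iraRec hrec, h.rida_of_iraRec hp (fun r x hx => (hγ r x hx).2) hrec⟩
  · rintro ⟨hida, hrida⟩
    obtain ⟨R, μ, h⟩ := hrd
    have hr : ∀ r, revealedAttention p R r r = 1 := fun r => if_pos rfl
    have hγ : ∀ r x, x ≠ r → 0 < revealedAttention p R r x ∧ revealedAttention p R r x < 1 :=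
      fun _ _ hx => h.revealedAttention_mem hp hx
    refine ⟨R, fun r => iraRule (revealedAttention p R r), ⟨h.1, fun r =>
      ⟨isAttentionRule_iraRule (hr r) (hγ r), fullSupport_iraRule (hr r) (hγ r)⟩,
      fun r S _ hrS x hx => ?_⟩, fun r => ⟨_, hr r, hγ r, fun S _ _ D _ hDS => if_pos hDS⟩⟩
    rw [(h.iraRec hp hida hrida r).unique h.1 (iraRec_iraChoice h.1 (hr r)) hrS hx]
    refine Finset.sum_congr rfl fun D hD => (if_pos ?_).symm
    exact Finset.mem_powerset.1 (Finset.mem_filter.1 hD).1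

end
end RDRAM
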